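/- Let Γ be a finite-dimensional algebra with domdim Γ = d and maximal projective-injective summand Π, and let 1 ≤ k ≤ d. Write T_k for the k-shifted module, B_k = End_Γ(T_k)^op for the k-shifted algebra, and T_j(T_k) = ∩_{i ≠ j} Ker Ext^i_Γ(T_k, −) for the tilting subcategories. Then T_j(T_k) equals: ∩_{i=1}^{k} Ker Ext^1_Γ(T_i, −) when j = 0; Ker Hom_Γ(Π, −) when j = k; and {0} otherwise. -/

import Mathlib

/-!
Formalization of definitions from "Special tilting modules for algebras with positive
dominant dimension" (Pressland–Sauter), together with one of its statements.
-/

open CategoryTheory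

noncomputable section
namespace PS

variable {R : Type} [Ring R]

/-- `N` is (isomorphic to) a direct summand of `M`. -/
def IsSummand (N M : ModuleCat.{0} R) : Prop :=
  ∃ (ι : N →ₗ[R] M) (π : M →ₗ[R] N), π ∘ₗ ι = LinearMap.id

/-- `M` lies in `add X`: it is a direct summand of a finite direct sum of copies of `X`. -/
def MemAdd (X M : ModuleCat.{0} R) : Prop :=
  ∃ n : ℕ, IsSummand M (ModuleCat.of R (Fin n → X))

/-- `M` is projective-injective. -/
def ProjInj (M : ModuleCat.{0} R) : Prop :=
  Module.Projective R M ∧ Module.Injective R M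

/-- The regular left module. -/
def reg (R : Type) [Ring R] : ModuleCat.{0} R := ModuleCat.of R R

/-- A module is basic if no nonzero module `X` has `X ⊕ X` as a direct summand of it
(equivalently, for finite length modules, its indecomposable direct summands are pairwise
non-isomorphic). -/
def IsBasic (M : ModuleCat.{0} R) : Prop :=
  ∀ X : ModuleCat.{0} R, IsSummand (ModuleCat.of R (X × X)) M → Subsingleton X

/-- `P` is a maximal projective-injective direct summand of the regular module. -/
def IsMaxProjInjSummand (P : ModuleCat.{0} R) : Prop :=
  IsSummand P (reg R) ∧ ProjInj P ∧
    ∀ Q : ModuleCat.{0} R, IsSummand Q (reg R) → ProjInj Q → MemAdd P Q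

/-- The data `Y 0 → Y 1 → ⋯ → Y n` forms an exact sequence
`0 → Y 0 → Y 1 → ⋯ → Y n → 0` (with `n ≥ 1` maps; terms beyond `Y n` are ignored). -/
def IsExactSeq (n : ℕ) (Y : ℕ → ModuleCat.{0} R) (f : ∀ i, Y i →ₗ[R] Y (i+1)) : Prop :=
  Function.Injective (f 0) ∧ Function.Surjective (f (n-1)) ∧
    ∀ i, i + 2 ≤ n → Function.Exact (f i) (f (i+1))

/-- The algebra `R` has dominant dimension at least `k`: the regular module has an
injective resolution whose first `k` terms are projective-injective. -/
def DomdimGE (R : Type) [Ring R] (k : ℕ) : Prop :=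
  ∃ (Y : ℕ → ModuleCat.{0} R) (g : reg R →ₗ[R] Y 0) (f : ∀ i, Y i →ₗ[R] Y (i+1)),
    Function.Injective g ∧ Function.Exact g (f 0) ∧
    (∀ i, Function.Exact (f i) (f (i+1))) ∧
    (∀ i, Module.Injective R (Y i)) ∧ (∀ i, i < k → Module.Projective R (Y i))

/-- `domdim R = d`. -/
def DomdimEq (R : Type) [Ring R] (d : ℕ) : Prop :=
  DomdimGE R d ∧ ¬ DomdimGE R (d+1)

/-- The Ext group `Ext^j(M, N)` in the category of `R`-modules. -/
def ext (M N : ModuleCat.{0} R) (j : ℕ) : Type :=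
  ((Ext ℤ (ModuleCat.{0} R) j).obj (Opposite.op M)).obj N

/-- `Ext^j(M, N) = 0` (for a single `j`). -/
def ExtZero (M N : ModuleCat.{0} R) (j : ℕ) : Prop := Subsingleton (ext M N j)

/-- `Ext^j(M, N) = 0` for all `j ≥ 1`. -/
def ExtVanishing (M N : ModuleCat.{0} R) : Prop :=
  ∀ j : ℕ, 1 ≤ j → ExtZero M N j

/-- Projective dimension at most `k`. -/
def PdimLE (k : ℕ) (M : ModuleCat.{0} R) : Prop :=
  ∃ (Y : ℕ → ModuleCat.{0} R) (f : ∀ i, Y i →ₗ[R] Y (i+1)),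
    IsExactSeq (k+1) Y f ∧ (∀ i, i ≤ k → Module.Projective R (Y i)) ∧ Y (k+1) = M

/-- Injective dimension at most `k`. -/
def IdimLE (k : ℕ) (M : ModuleCat.{0} R) : Prop :=
  ∃ (Y : ℕ → ModuleCat.{0} R) (f : ∀ i, Y i →ₗ[R] Y (i+1)),
    IsExactSeq (k+1) Y f ∧ (∀ i, 1 ≤ i → i ≤ k+1 → Module.Injective R (Y i)) ∧ Y 0 = M

/-- `T` is a `k`-tilting module. -/
def IsTilting (k : ℕ) (T : ModuleCat.{0} R) : Prop :=
  Module.Finite R T ∧ PdimLE k T ∧ ExtVanishing T T ∧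
    ∃ (Y : ℕ → ModuleCat.{0} R) (f : ∀ i, Y i →ₗ[R] Y (i+1)),
      IsExactSeq (k+1) Y f ∧ Y 0 = reg R ∧ ∀ i, 1 ≤ i → i ≤ k+1 → MemAdd T (Y i)

/-- `T` is a `P`-special `k`-tilting module: it is `k`-tilting, and there is a coresolution
`0 → R → t_0 → ⋯ → t_k → 0` with all `t_j ∈ add T` and `t_j ∈ add P` for `j ≤ k-1`. -/
def IsSpecialTilting (P : ModuleCat.{0} R) (k : ℕ) (T : ModuleCat.{0} R) : Prop :=
  IsTilting k T ∧
    ∃ (Y : ℕ → ModuleCat.{0} R) (f : ∀ i, Y i →ₗ[R] Y (i+1)),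
      IsExactSeq (k+1) Y f ∧ Y 0 = reg R ∧ (∀ i, 1 ≤ i → i ≤ k+1 → MemAdd T (Y i)) ∧
        (∀ i, 1 ≤ i → i ≤ k → MemAdd P (Y i))

/-- `M ∈ gen_k(X)`: there is an exact sequence `X^k → ⋯ → X^0 → M → 0` with `X^i ∈ add X`. -/
def MemGen (k : ℕ) (X M : ModuleCat.{0} R) : Prop :=
  ∃ (Y : ℕ → ModuleCat.{0} R) (f : ∀ i, Y i →ₗ[R] Y (i+1)),
    (∀ i, i ≤ k → MemAdd X (Y i)) ∧ Y (k+1) = M ∧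
    Function.Surjective (f k) ∧ ∀ i, i < k → Function.Exact (f i) (f (i+1))

/-- `M ∈ cogen^k(X)`: there is an exact sequence `0 → M → X_0 → ⋯ → X_k` with `X_i ∈ add X`. -/
def MemCogen (k : ℕ) (X M : ModuleCat.{0} R) : Prop :=
  ∃ (Y : ℕ → ModuleCat.{0} R) (f : ∀ i, Y i →ₗ[R] Y (i+1)),
    (∀ i, 1 ≤ i → i ≤ k+1 → MemAdd X (Y i)) ∧ Y 0 = M ∧
    Function.Injective (f 0) ∧ ∀ i, i < k → Function.Exact (f i) (f (i+1))

/-- `M ∈ gen_{k-1}(X)`, where `gen_{-1}(X)` is the whole module category. -/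
def MemGenShift : ℕ → ModuleCat.{0} R → ModuleCat.{0} R → Prop
  | 0, _X, _M => True
  | (k+1), X, M => MemGen k X M

/-- `M ∈ cogen^{k-1}(X)`, where `cogen^{-1}(X)` is the whole module category. -/
def MemCogenShift : ℕ → ModuleCat.{0} R → ModuleCat.{0} R → Prop
  | 0, _X, _M => True
  | (k+1), X, M => MemCogen k X M

/-- Global dimension at most `n` (on finitely generated modules). -/
def GldimLE (R : Type) [Ring R] (n : ℕ) : Prop :=
  ∀ M : ModuleCat.{0} R, Module.Finite R M → PdimLE n M

/-- Global dimension exactly `n`. -/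
def GldimEq (R : Type) [Ring R] (n : ℕ) : Prop :=
  GldimLE R n ∧ ∀ m : ℕ, GldimLE R m → n ≤ m

section Duality

variable (K : Type) [Field K]

section DualDefs
variable (S M : Type) [Semiring S] [AddCommGroup M] [Module K M]

/-- The action of `s : S` as a `K`-linear endomorphism. -/
def actMap [Module S M] [SMulCommClass S K M] (s : S) : M →ₗ[K] M where
  toFun m := s • m
  map_add' := smul_add s
  map_smul' c m := (smul_comm s c m)

/-- The `K`-linear dual of a left `S`-module is a left `Sᵐᵒᵖ`-module (i.e. a right
`S`-module), by precomposition. -/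
def dualModuleOp [Module S M] [SMulCommClass S K M] : Module Sᵐᵒᵖ (M →ₗ[K] K) where
  smul s φ := φ ∘ₗ actMap K S M s.unop
  one_smul φ := by ext m; exact congrArg φ (one_smul S m)
  mul_smul s t φ := by ext m; exact congrArg φ (mul_smul t.unop s.unop m)
  smul_zero s := by ext m; rfl
  smul_add s φ ψ := by ext m; rfl
  add_smul s t φ := by
    ext m
    show φ ((s.unop + t.unop) • m) = φ (s.unop • m) + φ (t.unop • m)
    rw [add_smul, map_add]
  zero_smul φ := by
    ext m
    show φ ((0 : S) • m) = 0
    rw [zero_smul, map_zero]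

/-- The `K`-linear dual of a right `S`-module is a left `S`-module, by precomposition. -/
def dualModuleUnop [Module Sᵐᵒᵖ M] [SMulCommClass Sᵐᵒᵖ K M] : Module S (M →ₗ[K] K) where
  smul s φ := φ ∘ₗ actMap K Sᵐᵒᵖ M (MulOpposite.op s)
  one_smul φ := by ext m; exact congrArg φ (one_smul Sᵐᵒᵖ m)
  mul_smul s t φ := by
    ext m
    show φ (MulOpposite.op (s * t) • m) = φ (MulOpposite.op t • MulOpposite.op s • m)
    rw [← mul_smul]
    rfl
  smul_zero s := by ext m; rfl
  smul_add s φ ψ := by ext m; rfl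
  add_smul s t φ := by
    ext m
    show φ ((MulOpposite.op s + MulOpposite.op t) • m)
      = φ (MulOpposite.op s • m) + φ (MulOpposite.op t • m)
    rw [add_smul, map_add]
  zero_smul φ := by
    ext m
    show φ ((0 : Sᵐᵒᵖ) • m) = 0
    rw [zero_smul, map_zero]

end DualDefs

/-- `D R`: the `K`-linear dual of the right regular module, as a left `R`-module. -/
def Dreg (R : Type) [Ring R] [Algebra K R] : ModuleCat.{0} R :=
  letI : Module R (R →ₗ[K] K) := dualModuleUnop K R R
  ModuleCat.of R (R →ₗ[K] K)

variable {R : Type} [Ring R] [Algebra K R]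

/-- The `K`-module structure on an `R`-module, via restriction of scalars. -/
def kMod (M : ModuleCat.{0} R) : Module K M := Module.compHom M (algebraMap K R)

theorem kMod_smulCommClass (M : ModuleCat.{0} R) :
    letI := kMod K M; SMulCommClass R K M := by
  letI := kMod K M
  constructor
  intro r c m
  show r • (algebraMap K R c • m) = algebraMap K R c • (r • m)
  rw [← mul_smul, ← mul_smul, Algebra.commutes]

theorem kMod_end_smulCommClass (M : ModuleCat.{0} R) :
    letI := kMod K M; SMulCommClass (Module.End R M) K M := by
  letI := kMod K M
  constructor
  intro f c m
  show f (algebraMap K R c • m) = algebraMap K R c • f m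
  rw [map_smul]

/-- The dual `D T` of a left `R`-module `T`, as a left module over `B = End_R(T)ᵒᵖ`. -/
def DT (T : ModuleCat.{0} R) : ModuleCat.{0} ((Module.End R T)ᵐᵒᵖ) :=
  letI := kMod K T
  letI := kMod_end_smulCommClass K T
  letI : Module (Module.End R T)ᵐᵒᵖ (T →ₗ[K] K) := dualModuleOp K (Module.End R T) T
  ModuleCat.of _ (T →ₗ[K] K)

/-- `C` is a `k`-cotilting module. -/
def IsCotilting (k : ℕ) (C : ModuleCat.{0} R) : Prop :=
  Module.Finite R C ∧ IdimLE k C ∧ ExtVanishing C C ∧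
    ∃ (Y : ℕ → ModuleCat.{0} R) (f : ∀ i, Y i →ₗ[R] Y (i+1)),
      IsExactSeq (k+1) Y f ∧ Y (k+1) = Dreg K R ∧ ∀ i, i ≤ k → MemAdd C (Y i)

/-- `C` is an `I`-special `k`-cotilting module: it is `k`-cotilting, and there is a resolution
`0 → c^k → ⋯ → c^0 → D R → 0` with all `c^j ∈ add C` and `c^j ∈ add I` for `j ≤ k-1`. -/
def IsSpecialCotilting (I : ModuleCat.{0} R) (k : ℕ) (C : ModuleCat.{0} R) : Prop :=
  IsCotilting K k C ∧
    ∃ (Y : ℕ → ModuleCat.{0} R) (f : ∀ i, Y i →ₗ[R] Y (i+1)),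
      IsExactSeq (k+1) Y f ∧ Y (k+1) = Dreg K R ∧ (∀ i, i ≤ k → MemAdd C (Y i)) ∧
        (∀ i, 1 ≤ i → i ≤ k → MemAdd I (Y i))

/-- `R` is a `d`-Auslander–Gorenstein algebra: `id R ≤ d+1 ≤ domdim R`. -/
def IsAuslanderGorenstein (R : Type) [Ring R] (d : ℕ) : Prop :=
  IdimLE (d+1) (reg R) ∧ DomdimGE R (d+1)

/-- `R` is a `d`-Auslander algebra: `gldim R ≤ d+1 ≤ domdim R`. -/
def IsAuslander (R : Type) [Ring R] (d : ℕ) : Prop :=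
  GldimLE R (d+1) ∧ DomdimGE R (d+1)

end Duality

end PS
end

namespace PS
section Bridge
variable {R : Type} [Ring R]

lemma exactAt_iff_cocycle (X M : ModuleCat.{0} R) (P : ProjectiveResolution X) (n p : ℕ)
    (hp : (ComplexShape.up ℕ).prev n = p) :
    ExtZero X M n ↔ ∀ f : P.complex.X n ⟶ M, P.complex.d (n+1) n ≫ f = 0 →
      ∃ g : P.complex.X p ⟶ M, P.complex.d n p ≫ g = f := by
  have h1 : ExtZero X M n ↔
      Limits.IsZero (((Ext ℤ (ModuleCat.{0} R) n).obj (Opposite.op X)).obj M) :=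
    ModuleCat.isZero_iff_subsingleton.symm
  rw [h1, (P.isoExt (R := ℤ) n M).isZero_iff, ← HomologicalComplex.exactAt_iff_isZero_homology,
    HomologicalComplex.exactAt_iff' _ p n (n+1) hp (by simp), ShortComplex.moduleCat_exact_iff]
  constructor
  · intro h f hf
    exact h f hf
  · intro h f hf
    exact h f hf

lemma extZero_iff (X M : ModuleCat.{0} R) (n : ℕ) :
    ExtZero X M n ↔ Subsingleton (Abelian.Ext.{0} X M n) := by
  let P := projectiveResolution X
  cases n with
  | zero =>
    rw [exactAt_iff_cocycle X M P 0 0 (by simp)]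
    have e : Subsingleton (Abelian.Ext.{0} X M 0) ↔
        Subsingleton (((ChainComplex.single₀ (ModuleCat R)).obj X).X 0 ⟶ M) :=
      Abelian.Ext.homEquiv₀.subsingleton_congr
    rw [e]
    have hd : P.complex.d 0 0 = 0 := P.complex.shape _ _ (by simp)
    constructor
    · intro h
      refine subsingleton_of_forall_eq 0 fun g => ?_
      obtain ⟨g', hg'⟩ := h (P.π.f 0 ≫ g) (by
        have := P.complex_d_comp_π_f_zero
        rw [← Category.assoc]
        erw [this]; exact Limits.zero_comp)
      rw [hd, Limits.zero_comp] at hg'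
      rw [← cancel_epi (P.π.f 0), ← hg', Limits.comp_zero]
    · intro h f hf
      refine ⟨0, ?_⟩
      have hex := P.exact₀
      have h1 : f = P.π.f 0 ≫ hex.desc f hf := (hex.g_desc f hf).symm
      have h2 : hex.desc f hf = 0 := h.elim _ _
      rw [Limits.comp_zero, h1, h2, Limits.comp_zero]
  | succ n =>
    rw [exactAt_iff_cocycle X M P (n+1) n (by simp)]
    constructor
    · intro h
      refine subsingleton_of_forall_eq 0 fun α => ?_
      obtain ⟨f, hf, rfl⟩ := P.extMk_surjective α (n+2) rfl
      exact (P.extMk_eq_zero_iff f (n+2) rfl hf n rfl).2 (h f hf)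
    · intro h f hf
      exact (P.extMk_eq_zero_iff f (n+2) rfl hf n rfl).1 (Subsingleton.elim _ _)

end Bridge
end PS
namespace PS
section Toolkit
variable {R : Type} [Ring R]

lemma extZero_zero_iff (X M : ModuleCat.{0} R) : ExtZero X M 0 ↔ Subsingleton (X →ₗ[R] M) := by
  rw [extZero_iff]
  exact (Abelian.Ext.homEquiv₀.trans ModuleCat.homEquiv).subsingleton_congr

lemma extZero_of_projective {X : ModuleCat.{0} R} (hX : Module.Projective R X)
    (M : ModuleCat.{0} R) {n : ℕ} (hn : 1 ≤ n) : ExtZero X M n := by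
  obtain ⟨n, rfl⟩ := Nat.exists_eq_add_of_le' hn
  rw [extZero_iff]
  have : Projective X := (IsProjective.iff_projective (R := R) X).1 hX
  exact Abelian.Ext.subsingleton_of_projective _ _ _

lemma extZero_of_sum {ι : Type} [Fintype ι] {X M : ModuleCat.{0} R} {n : ℕ}
    (Z : ι → ModuleCat.{0} R) (f : ∀ i, X →ₗ[R] Z i) (g : ∀ i, Z i →ₗ[R] X)
    (h : ∀ x, ∑ i, g i (f i x) = x) (hZ : ∀ i, ExtZero (Z i) M n) : ExtZero X M n := by
  simp only [extZero_iff] at *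
  refine subsingleton_of_forall_eq 0 fun α => ?_
  have hid : 𝟙 X = ∑ i, ModuleCat.ofHom (f i) ≫ ModuleCat.ofHom (g i) := by
    ext x
    simp [ModuleCat.hom_sum, h]
  rw [← Abelian.Ext.mk₀_id_comp α, hid, Abelian.Ext.mk₀_sum, Abelian.Ext.sum_comp]
  refine Finset.sum_eq_zero fun i _ => ?_
  rw [← Abelian.Ext.mk₀_comp_mk₀_assoc,
    Subsingleton.elim ((Abelian.Ext.mk₀ (ModuleCat.ofHom (g i))).comp α (zero_add n)) 0,
    Abelian.Ext.comp_zero]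

lemma extZero_of_sum_right {ι : Type} [Fintype ι] {X M : ModuleCat.{0} R} {n : ℕ}
    (Z : ι → ModuleCat.{0} R) (f : ∀ i, M →ₗ[R] Z i) (g : ∀ i, Z i →ₗ[R] M)
    (h : ∀ x, ∑ i, g i (f i x) = x) (hZ : ∀ i, ExtZero X (Z i) n) : ExtZero X M n := by
  simp only [extZero_iff] at *
  refine subsingleton_of_forall_eq 0 fun α => ?_
  have hid : 𝟙 M = ∑ i, ModuleCat.ofHom (f i) ≫ ModuleCat.ofHom (g i) := by
    ext x
    simp [ModuleCat.hom_sum, h]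
  rw [← Abelian.Ext.comp_mk₀_id α, hid, Abelian.Ext.mk₀_sum, Abelian.Ext.comp_sum]
  refine Finset.sum_eq_zero fun i _ => ?_
  rw [← Abelian.Ext.mk₀_comp_mk₀, ← Abelian.Ext.comp_assoc_of_second_deg_zero,
    Subsingleton.elim (α.comp (Abelian.Ext.mk₀ (ModuleCat.ofHom (f i))) (add_zero n)) 0,
    Abelian.Ext.zero_comp]

lemma memAdd_decomp {X M : ModuleCat.{0} R} (h : MemAdd X M) :
    ∃ (n : ℕ) (f : Fin n → (M →ₗ[R] X)) (g : Fin n → (X →ₗ[R] M)),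
      ∀ x, ∑ i, g i (f i x) = x := by
  obtain ⟨n, i, p, h⟩ := h
  refine ⟨n, fun j => LinearMap.proj j ∘ₗ i, fun j => p ∘ₗ LinearMap.single R (fun _ => X) j, ?_⟩
  intro x
  have h2 := LinearMap.congr_fun h x
  simp only [LinearMap.comp_apply, LinearMap.id_apply] at h2
  conv_rhs => rw [← h2]
  simp only [LinearMap.comp_apply]
  rw [← map_sum]
  congr 1
  exact LinearMap.sum_single_apply _ (i x)

lemma memAdd_of_decomp {X M : ModuleCat.{0} R} {n : ℕ} (f : Fin n → (M →ₗ[R] X))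
    (g : Fin n → (X →ₗ[R] M)) (h : ∀ x, ∑ i, g i (f i x) = x) : MemAdd X M := by
  refine ⟨n, LinearMap.pi f, ∑ i, g i ∘ₗ LinearMap.proj i, ?_⟩
  ext x
  simpa using h x

lemma extZero_of_memAdd {X Y M : ModuleCat.{0} R} {n : ℕ} (h : MemAdd X Y)
    (hX : ExtZero X M n) : ExtZero Y M n := by
  obtain ⟨m, f, g, h⟩ := memAdd_decomp h
  exact extZero_of_sum (fun _ => X) f g h (fun _ => hX)

lemma extZero_of_memAdd_right {X Y M : ModuleCat.{0} R} {n : ℕ} (h : MemAdd X Y)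
    (hX : ExtZero M X n) : ExtZero M Y n := by
  obtain ⟨m, f, g, h⟩ := memAdd_decomp h
  exact extZero_of_sum_right (fun _ => X) f g h (fun _ => hX)

lemma extZero_of_two {X M Z W : ModuleCat.{0} R} {n : ℕ}
    (f : X →ₗ[R] Z) (g : Z →ₗ[R] X) (f' : X →ₗ[R] W) (g' : W →ₗ[R] X)
    (h : ∀ x, g (f x) + g' (f' x) = x) (hZ : ExtZero Z M n) (hW : ExtZero W M n) :
    ExtZero X M n := by
  refine extZero_of_sum (ι := Bool) (fun b => Bool.rec Z W b)
    (fun b => Bool.rec f f' b) (fun b => Bool.rec g g' b) ?_ ?_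
  · intro x; simpa [add_comm] using h x
  · rintro (_ | _)
    · exact hZ
    · exact hW

lemma extZero_of_two_right {X M Z W : ModuleCat.{0} R} {n : ℕ}
    (f : M →ₗ[R] Z) (g : Z →ₗ[R] M) (f' : M →ₗ[R] W) (g' : W →ₗ[R] M)
    (h : ∀ x, g (f x) + g' (f' x) = x) (hZ : ExtZero X Z n) (hW : ExtZero X W n) :
    ExtZero X M n := by
  refine extZero_of_sum_right (ι := Bool) (fun b => Bool.rec Z W b)
    (fun b => Bool.rec f f' b) (fun b => Bool.rec g g' b) ?_ ?_
  · intro x; simpa [add_comm] using h x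
  · rintro (_ | _)
    · exact hZ
    · exact hW

/-- Short exact sequences, unbundled. -/
structure SES {A B C : ModuleCat.{0} R} (f : A →ₗ[R] B) (g : B →ₗ[R] C) : Prop where
  inj : Function.Injective f
  exact : Function.Exact f g
  surj : Function.Surjective g

variable {A B C : ModuleCat.{0} R} {f : A →ₗ[R] B} {g : B →ₗ[R] C}

/-- The bundled short complex. -/
def SES.sc (h : SES f g) : ShortComplex (ModuleCat.{0} R) :=
  ShortComplex.mk (ModuleCat.ofHom f) (ModuleCat.ofHom g) (by
    ext x; simpa using h.exact.apply_apply_eq_zero x)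

lemma SES.shortExact (h : SES f g) : h.sc.ShortExact where
  exact := (ShortComplex.ShortExact.moduleCat_exact_iff_function_exact _).2 h.exact
  mono_f := (ModuleCat.mono_iff_injective _).2 h.inj
  epi_g := (ModuleCat.epi_iff_surjective _).2 h.surj

lemma SES.ext_left₁ (h : SES f g) {M : ModuleCat.{0} R} {n : ℕ}
    (hB : ExtZero B M n) (hC : ExtZero C M (n+1)) : ExtZero A M n := by
  rw [extZero_iff] at *
  refine subsingleton_of_forall_eq 0 fun α => ?_
  obtain ⟨x, hx⟩ := Abelian.Ext.contravariant_sequence_exact₁ h.shortExact M α (add_comm 1 n)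
    (hC.elim _ _)
  obtain rfl : x = 0 := hB.elim _ _
  rw [← hx]
  exact Abelian.Ext.comp_zero ..

lemma SES.ext_left₃ (h : SES f g) {M : ModuleCat.{0} R} {n : ℕ}
    (hA : ExtZero A M n) (hB : ExtZero B M (n+1)) : ExtZero C M (n+1) := by
  rw [extZero_iff] at *
  refine subsingleton_of_forall_eq 0 fun α => ?_
  obtain ⟨x, hx⟩ := Abelian.Ext.contravariant_sequence_exact₃ h.shortExact M α
    (hB.elim _ _) (add_comm 1 n)
  obtain rfl : x = 0 := hA.elim _ _
  rw [← hx]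
  exact Abelian.Ext.comp_zero ..

lemma SES.ext_right₁ (h : SES f g) {X : ModuleCat.{0} R} {n : ℕ}
    (hC : ExtZero X C n) (hB : ExtZero X B (n+1)) : ExtZero X A (n+1) := by
  rw [extZero_iff] at *
  refine subsingleton_of_forall_eq 0 fun α => ?_
  obtain ⟨x, hx⟩ := Abelian.Ext.covariant_sequence_exact₁ X h.shortExact α
    (hB.elim _ _) rfl
  obtain rfl : x = 0 := hC.elim _ _
  rw [← hx]
  exact Abelian.Ext.zero_comp ..

lemma SES.ext_right₃ (h : SES f g) {X : ModuleCat.{0} R} {n : ℕ}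
    (hB : ExtZero X B n) (hA : ExtZero X A (n+1)) : ExtZero X C n := by
  rw [extZero_iff] at *
  refine subsingleton_of_forall_eq 0 fun α => ?_
  obtain ⟨x, hx⟩ := Abelian.Ext.covariant_sequence_exact₃ X h.shortExact α rfl
    (hA.elim _ _)
  obtain rfl : x = 0 := hB.elim _ _
  rw [← hx]
  exact Abelian.Ext.zero_comp ..

lemma SES.lift (h : SES f g) {X : ModuleCat.{0} R} (hA : ExtZero X A 1) (u : X →ₗ[R] C) :
    ∃ v : X →ₗ[R] B, g ∘ₗ v = u := by
  rw [extZero_iff] at *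
  obtain ⟨x, hx⟩ := Abelian.Ext.covariant_sequence_exact₃ X h.shortExact
    (Abelian.Ext.mk₀ (ModuleCat.ofHom u)) rfl (hA.elim _ _)
  obtain ⟨v, rfl⟩ := (Abelian.Ext.mk₀_bijective _ _).2 x
  rw [Abelian.Ext.mk₀_comp_mk₀] at hx
  have := (Abelian.Ext.mk₀_bijective _ _).1 hx
  exact ⟨v.hom, congrArg ModuleCat.Hom.hom this⟩

lemma SES.extend (h : SES f g) {M : ModuleCat.{0} R} (hC : ExtZero C M 1) (u : A →ₗ[R] M) :
    ∃ v : B →ₗ[R] M, v ∘ₗ f = u := by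
  rw [extZero_iff] at *
  obtain ⟨x, hx⟩ := Abelian.Ext.contravariant_sequence_exact₁ h.shortExact M
    (Abelian.Ext.mk₀ (ModuleCat.ofHom u)) (n₁ := 1) rfl (hC.elim _ _)
  obtain ⟨v, rfl⟩ := (Abelian.Ext.mk₀_bijective _ _).2 x
  rw [Abelian.Ext.mk₀_comp_mk₀] at hx
  have := (Abelian.Ext.mk₀_bijective _ _).1 hx
  exact ⟨v.hom, congrArg ModuleCat.Hom.hom this⟩

lemma SES.ext_right_one (h : SES f g) {X : ModuleCat.{0} R}
    (hC : ∀ u : X →ₗ[R] C, ∃ v : X →ₗ[R] B, g ∘ₗ v = u) (hB : ExtZero X B 1) :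
    ExtZero X A 1 := by
  rw [extZero_iff] at *
  refine subsingleton_of_forall_eq 0 fun α => ?_
  obtain ⟨x, hx⟩ := Abelian.Ext.covariant_sequence_exact₁ X h.shortExact α
    (hB.elim _ _) (zero_add 1)
  obtain ⟨u, rfl⟩ := (Abelian.Ext.mk₀_bijective _ _).2 x
  obtain ⟨v, hv⟩ := hC u.hom
  obtain ⟨w, hw⟩ : ∃ w : X ⟶ h.sc.X₂, u = w ≫ h.sc.g :=
    ⟨ModuleCat.ofHom v, by
      ext x
      exact (LinearMap.congr_fun hv x).symm⟩
  rw [← hx, hw, ← Abelian.Ext.mk₀_comp_mk₀, Abelian.Ext.comp_assoc_of_second_deg_zero,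
    h.shortExact.comp_extClass]
  exact Abelian.Ext.comp_zero ..

lemma SES.desc (h : SES f g) {X : ModuleCat.{0} R} (u : B →ₗ[R] X) (hu : ∀ x, u (f x) = 0) :
    ∃ v : C →ₗ[R] X, ∀ x, v (g x) = u x := by
  refine ⟨(LinearMap.ker g).liftQ u ?_ ∘ₗ (g.quotKerEquivOfSurjective h.surj).symm, ?_⟩
  · intro x hx
    obtain ⟨y, rfl⟩ := (h.exact x).1 hx
    exact hu y
  · intro x
    have : (g.quotKerEquivOfSurjective h.surj).symm (g x) = Submodule.Quotient.mk x := by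
      rw [LinearEquiv.symm_apply_eq]; rfl
    simp [this]

lemma SES.kernel {n : B →ₗ[R] C} (hn : Function.Surjective n) :
    SES (A := ModuleCat.of R (LinearMap.ker n)) (LinearMap.ker n).subtype n where
  inj := Subtype.val_injective
  exact := LinearMap.exact_subtype_ker_map n
  surj := hn

end Toolkit
end PS
namespace PS
section Core
variable {R : Type} [Ring R]

lemma ExtZero.congr {X Y M : ModuleCat.{0} R} {n : ℕ} (e : X ≃ₗ[R] Y) (h : ExtZero X M n) :
    ExtZero Y M n :=
  extZero_of_sum (ι := Unit) (fun _ => X) (fun _ => e.symm.toLinearMap) (fun _ => e.toLinearMap)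
    (by simp) (fun _ => h)

lemma memAdd_of_summand {X Y Z : ModuleCat.{0} R} (h : MemAdd X Y) (i : Z →ₗ[R] Y)
    (p : Y →ₗ[R] Z) (hp : ∀ z, p (i z) = z) : MemAdd X Z := by
  obtain ⟨n, f, g, h⟩ := h
  refine ⟨n, f ∘ₗ i, p ∘ₗ g, ?_⟩
  ext z
  have := LinearMap.congr_fun h (i z)
  simp only [LinearMap.comp_apply, LinearMap.id_apply] at this ⊢
  rw [this, hp]

/-- Images in an exact sequence. -/
lemma exists_images {k : ℕ} {Y : ℕ → ModuleCat.{0} R} {f : ∀ i, Y i →ₗ[R] Y (i+1)}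
    (h : IsExactSeq (k+1) Y f) :
    ∃ c : ℕ → ModuleCat.{0} R, Nonempty (Y 0 ≃ₗ[R] c 0) ∧ Nonempty (c k ≃ₗ[R] Y (k+1)) ∧
      ∀ i, i < k → ∃ (a : c i →ₗ[R] Y (i+1)) (b : Y (i+1) →ₗ[R] c (i+1)), SES a b := by
  obtain ⟨h0, h1, h2⟩ := h
  refine ⟨fun i => ModuleCat.of R (LinearMap.range (f i)), ⟨LinearEquiv.ofInjective (f 0) h0⟩,
    ⟨LinearEquiv.ofTop _ (LinearMap.range_eq_top.2 h1)⟩, fun i hi =>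
      ⟨(LinearMap.range (f i)).subtype, (f (i+1)).rangeRestrict, ?_, ?_, ?_⟩⟩
  · exact Subtype.val_injective
  · intro x
    have := h2 i (by omega) x
    simp only [Submodule.subtype_apply, Set.mem_range, Subtype.exists, LinearMap.mem_range]
    constructor
    · intro hx
      obtain ⟨y, hy⟩ := this.1 (congrArg Subtype.val hx)
      exact ⟨x, ⟨y, hy⟩, rfl⟩
    · rintro ⟨_, ⟨y, hy⟩, rfl⟩
      exact Subtype.ext (this.2 ⟨y, hy⟩)
  · exact LinearMap.surjective_rangeRestrict _

lemma PdimLE.extZero {k : ℕ} {T : ModuleCat.{0} R} (h : PdimLE k T) (M : ModuleCat.{0} R)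
    {n : ℕ} (hn : k + 1 ≤ n) : ExtZero T M n := by
  obtain ⟨Y, f, hex, hproj, rfl⟩ := h
  obtain ⟨c, ⟨e0⟩, ⟨ek⟩, hc⟩ := exists_images hex
  have key : ∀ i, i ≤ k → ∀ n, i + 1 ≤ n → ExtZero (c i) M n := by
    intro i
    induction i with
    | zero =>
      intro _ n hn
      exact ExtZero.congr e0 (extZero_of_projective (hproj 0 (by omega)) M (by omega))
    | succ i ih =>
      intro hi n hn
      obtain ⟨a, b, hs⟩ := hc i (by omega)
      obtain ⟨n, rfl⟩ : ∃ m, n = m + 1 := ⟨n - 1, by omega⟩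
      exact hs.ext_left₃ (ih (by omega) n (by omega))
        (extZero_of_projective (hproj _ (by omega)) M (by omega))
  exact ExtZero.congr ek (key k le_rfl n hn)

/-- A coresolution with middle terms in `add P`. -/
structure Cores (P : ModuleCat.{0} R) (k : ℕ) (c Q : ℕ → ModuleCat.{0} R) : Prop where
  start : Nonempty (reg R ≃ₗ[R] c 0)
  mem : ∀ i, i < k → MemAdd P (Q i)
  ses : ∀ i, i < k → ∃ (a : c i →ₗ[R] Q i) (b : Q i →ₗ[R] c (i+1)), SES a b

lemma projective_of_memAdd {P Q : ModuleCat.{0} R} (hP : Module.Projective R P)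
    (h : MemAdd P Q) : Module.Projective R Q := by
  obtain ⟨n, i, p, h⟩ := h
  have : Module.Projective R (Fin n → P) :=
    Module.Projective.of_equiv (DirectSum.linearEquivFunOnFintype R (Fin n) (fun _ => (P : Type)))
  exact Module.Projective.of_split (M := (Fin n → P)) i p h

lemma injective_of_memAdd {P Q : ModuleCat.{0} R} (hP : Module.Injective R P)
    (h : MemAdd P Q) : Module.Injective R Q := by
  obtain ⟨n, i, p, h⟩ := h
  have : Module.Injective R (Fin n → P) := inferInstance
  refine ⟨fun X Y _ _ _ _ f hf g => ?_⟩
  obtain ⟨u, hu⟩ := this.out f hf (i ∘ₗ g)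
  refine ⟨p ∘ₗ u, fun x => ?_⟩
  rw [LinearMap.comp_apply, hu]
  exact LinearMap.congr_fun h (g x)

variable {P : ModuleCat.{0} R} {k : ℕ} {c Q : ℕ → ModuleCat.{0} R}

lemma Cores.mono (h : Cores P k c Q) {i : ℕ} (hi : i ≤ k) : Cores P i c Q :=
  ⟨h.start, fun j hj => h.mem j (by omega), fun j hj => h.ses j (by omega)⟩

lemma Cores.shift (h : Cores P k c Q) (hP : Module.Projective R P) (M : ModuleCat.{0} R)
    {n : ℕ} (hn : 1 ≤ n) (m : ℕ) : ∀ i, i + m ≤ k →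
      (ExtZero (c (i+m)) M (n + m) ↔ ExtZero (c i) M n) := by
  induction m with
  | zero => intro i _; rfl
  | succ m ih =>
    intro i hi
    rw [← ih i (by omega)]
    obtain ⟨a, b, hs⟩ := h.ses (i+m) (by omega)
    have hQ := projective_of_memAdd hP (h.mem (i+m) (by omega))
    exact ⟨fun h => hs.ext_left₁ (extZero_of_projective hQ M (by omega)) h,
      fun h => hs.ext_left₃ h (extZero_of_projective hQ M (by omega))⟩

lemma reg_projective : Module.Projective R (reg R) :=
  inferInstanceAs (Module.Projective R R)

lemma Cores.extZero_gt (h : Cores P k c Q) (hP : Module.Projective R P) (M : ModuleCat.{0} R)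
    {n : ℕ} (hn : k + 1 ≤ n) : ExtZero (c k) M n := by
  have := (h.shift hP M (n := n - k) (by omega) k 0 (by omega)).2 (by
    obtain ⟨e⟩ := h.start
    exact ExtZero.congr e (extZero_of_projective reg_projective M (by omega)))
  simpa [Nat.sub_add_cancel (show k ≤ n by omega)] using this

/-- Stable Schanuel step. -/
lemma schanuel_step {A Q C B Q' C' E : ModuleCat.{0} R}
    {a : A →ₗ[R] Q} {q : Q →ₗ[R] C} (h : SES a q)
    {b : B →ₗ[R] Q'} {q' : Q' →ₗ[R] C'} (h' : SES b q')
    (hQ : Module.Injective R Q) (hQ' : Module.Injective R Q') (hE : Module.Injective R E)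
    (i₁ : A →ₗ[R] B) (i₂ : A →ₗ[R] E) (r₁ : B →ₗ[R] A) (r₂ : E →ₗ[R] A)
    (hr : ∀ x, r₁ (i₁ x) + r₂ (i₂ x) = x) :
    ∃ (f : C →ₗ[R] C') (u : C →ₗ[R] Q) (g : C' →ₗ[R] C) (v : Q →ₗ[R] C),
      ∀ x, g (f x) + v (u x) = x := by
  obtain ⟨I₁, hI₁⟩ := hQ'.out a h.inj (b ∘ₗ i₁)
  obtain ⟨I₂, hI₂⟩ := hE.out a h.inj i₂
  obtain ⟨R₁, hR₁⟩ := hQ.out b h'.inj (a ∘ₗ r₁)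
  simp only [LinearMap.comp_apply] at hI₁ hR₁
  obtain ⟨f, hf⟩ := h.desc (q' ∘ₗ I₁) (fun x => by
    simp [hI₁, h'.exact.apply_apply_eq_zero])
  obtain ⟨g, hg⟩ := h'.desc (q ∘ₗ R₁) (fun x => by
    simp [hR₁, h.exact.apply_apply_eq_zero])
  obtain ⟨u, hu⟩ := h.desc (LinearMap.id - R₁ ∘ₗ I₁ - a ∘ₗ r₂ ∘ₗ I₂) (fun x => by
    simp only [LinearMap.sub_apply, LinearMap.comp_apply, LinearMap.id_apply, hI₁, hI₂, hR₁]
    rw [sub_sub, ← map_add, hr, sub_self])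
  refine ⟨f, u, g, q, fun x => ?_⟩
  obtain ⟨y, rfl⟩ := h.surj x
  rw [hf, hu, LinearMap.comp_apply, hg]
  simp [h.exact.apply_apply_eq_zero]

lemma Cores.stable (hP : ProjInj P) (h : Cores P k c Q) {c' Q' : ℕ → ModuleCat.{0} R}
    (h' : Cores P k c' Q') : ∀ m, m ≤ k → ∃ (E : ModuleCat.{0} R) (f : c m →ₗ[R] c' m)
      (u : c m →ₗ[R] E) (g : c' m →ₗ[R] c m) (v : E →ₗ[R] c m),
      ProjInj E ∧ ∀ x, g (f x) + v (u x) = x := by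
  intro m
  induction m with
  | zero =>
    intro _
    obtain ⟨e⟩ := h.start
    obtain ⟨e'⟩ := h'.start
    refine ⟨P, (e.symm.trans e').toLinearMap, 0, (e'.symm.trans e).toLinearMap, 0, hP, ?_⟩
    intro x; simp
  | succ m ih =>
    intro hm
    obtain ⟨E, f, u, g, v, hE, hid⟩ := ih (by omega)
    obtain ⟨a, q, hs⟩ := h.ses m (by omega)
    obtain ⟨a', q', hs'⟩ := h'.ses m (by omega)
    have hQ := injective_of_memAdd hP.2 (h.mem m (by omega))
    obtain ⟨f₁, u₁, g₁, v₁, h₁⟩ := schanuel_step hs hs' hQ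
      (injective_of_memAdd hP.2 (h'.mem m (by omega))) hE.2 f u g v hid
    exact ⟨Q m, f₁, u₁, g₁, v₁, ⟨projective_of_memAdd hP.1 (h.mem m (by omega)), hQ⟩, h₁⟩

lemma Cores.extZero_of_cores (hP : ProjInj P) (h : Cores P k c Q) {c' Q' : ℕ → ModuleCat.{0} R}
    (h' : Cores P k c' Q') {m : ℕ} (hm : m ≤ k) {M : ModuleCat.{0} R} {n : ℕ} (hn : 1 ≤ n)
    (hz : ExtZero (c' m) M n) : ExtZero (c m) M n := by
  obtain ⟨E, f, u, g, v, hE, hid⟩ := h.stable hP h' m hm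
  exact extZero_of_two f g u v hid hz (extZero_of_projective hE.1 M hn)

lemma IsSpecialTilting.cores {T : ModuleCat.{0} R} (h : IsSpecialTilting P k T) :
    ∃ c Q : ℕ → ModuleCat.{0} R, Cores P k c Q ∧ MemAdd T (c k) ∧
      ∀ i, i < k → MemAdd T (Q i) := by
  obtain ⟨-, Y, f, hex, h0, hT, hPm⟩ := h
  obtain ⟨c, e0, ⟨ek⟩, hc⟩ := exists_images hex
  refine ⟨c, fun i => Y (i+1), ⟨?_, fun i hi => hPm _ (by omega) (by omega), hc⟩, ?_,
    fun i hi => hT _ (by omega) (by omega)⟩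
  · rw [← h0]; exact e0
  · exact memAdd_of_summand (hT (k+1) (by omega) le_rfl) ek.toLinearMap ek.symm.toLinearMap
      (by simp)

lemma Cores.proj_memAdd {T : ModuleCat.{0} R} (h : Cores P k c Q) (hk : 1 ≤ k)
    (hP : Module.Injective R P) (hs : IsSummand P (reg R)) (hT : MemAdd T (Q 0)) :
    MemAdd T P := by
  obtain ⟨i, p, hip⟩ := hs
  obtain ⟨e⟩ := h.start
  obtain ⟨a, b, hab⟩ := h.ses 0 (by omega)
  have hi : Function.Injective i :=
    Function.LeftInverse.injective (g := p) (fun x => LinearMap.congr_fun hip x)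
  obtain ⟨r, hr⟩ := hP.out (a ∘ₗ e.toLinearMap ∘ₗ i) (hab.inj.comp (e.injective.comp hi))
    LinearMap.id
  exact memAdd_of_summand hT _ r hr

end Core
end PS
namespace PS
section Approx
variable {R : Type} [Ring R]

lemma exists_hom_generators (K : Type) [Field K] [Algebra K R] [FiniteDimensional K R] (W N : ModuleCat.{0} R)
    (hW : Module.Finite R W) (hN : Module.Finite R N) :
    ∃ (n : ℕ) (φ : Fin n → (W →ₗ[R] N)), ∀ ψ : W →ₗ[R] N,
      ∃ e : Fin n → (W →ₗ[R] W), ∀ w, ∑ i, φ i (e i w) = ψ w := by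
  let _ : Module K W := Module.compHom W (algebraMap K R)
  let _ : Module K N := Module.compHom N (algebraMap K R)
  have : IsScalarTower K R W := IsScalarTower.of_algebraMap_smul (fun _ _ => rfl)
  have : IsScalarTower K R N := IsScalarTower.of_algebraMap_smul (fun _ _ => rfl)
  have : Module.Finite K W := Module.Finite.trans R W
  have : Module.Finite K N := Module.Finite.trans R N
  have : SMulCommClass R K W := IsScalarTower.to_smulCommClass'
  have : SMulCommClass R K N := IsScalarTower.to_smulCommClass'
  have hfin : Module.Finite K (W →ₗ[R] N) :=
    Module.Finite.of_injective (LinearMap.restrictScalarsₗ K R W N K)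
      (LinearMap.restrictScalars_injective K)
  obtain ⟨n, φ, hφ⟩ := Module.Finite.exists_fin (R := K) (M := (W →ₗ[R] N))
  refine ⟨n, φ, fun ψ => ?_⟩
  have hψ : ψ ∈ Submodule.span K (Set.range φ) := by rw [hφ]; trivial
  obtain ⟨a, ha⟩ := (Submodule.mem_span_range_iff_exists_fun K).1 hψ
  refine ⟨fun i => a i • LinearMap.id, fun w => ?_⟩
  rw [← ha]
  simp only [LinearMap.sum_apply, LinearMap.smul_apply, LinearMap.id_apply]
  refine Finset.sum_congr rfl fun i _ => ?_
  show φ i (algebraMap K R (a i) • w) = algebraMap K R (a i) • φ i w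
  exact map_smul _ _ _

lemma lift_of_memAdd {B N X Y : ModuleCat.{0} R} (p : B →ₗ[R] N) (h : MemAdd X Y)
    (hX : ∀ u : X →ₗ[R] N, ∃ v : X →ₗ[R] B, p ∘ₗ v = u) (u : Y →ₗ[R] N) :
    ∃ v : Y →ₗ[R] B, p ∘ₗ v = u := by
  obtain ⟨n, f, g, h⟩ := memAdd_decomp h
  choose v hv using fun i => hX (u ∘ₗ g i)
  refine ⟨∑ i, v i ∘ₗ f i, ?_⟩
  ext y
  have := fun i x => LinearMap.congr_fun (hv i) x
  simp only [LinearMap.comp_apply] at this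
  simp only [LinearMap.comp_apply, LinearMap.sum_apply, map_sum, this]
  rw [← map_sum, h]

variable {P T : ModuleCat.{0} R} {k : ℕ} {c Q : ℕ → ModuleCat.{0} R}

lemma exists_from_reg (M : ModuleCat.{0} R) (x : M) :
    ∃ (u : reg R →ₗ[R] M) (o : reg R), u o = x :=
  ⟨LinearMap.toSpanSingleton R M x, (1 : R), (show (1 : R) • x = x from one_smul R x)⟩

lemma finite_of_memAdd {X Y : ModuleCat.{0} R} (h : MemAdd X Y) (hX : Module.Finite R X) :
    Module.Finite R Y := by
  obtain ⟨n, i, p, h⟩ := h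
  have : Module.Finite R (Fin n → X) := inferInstance
  exact Module.Finite.of_surjective (M := (Fin n → X)) p
    (Function.RightInverse.surjective (g := i) (fun x => LinearMap.congr_fun h x))

lemma exists_approx (K : Type) [Field K] [Algebra K R] [FiniteDimensional K R] (h : Cores P k c Q) (hk : 1 ≤ k)
    (hP : Module.Projective R P)
    (hPf : Module.Finite R P) (hcf : Module.Finite R (c k))
    (hcP : ∀ j, 1 ≤ j → ExtZero (c k) P j) (hcc : ∀ j, 1 ≤ j → ExtZero (c k) (c k) j)
    (N : ModuleCat.{0} R) (hN : Module.Finite R N) (hNc : ∀ j, 1 ≤ j → ExtZero (c k) N j) :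
    ∃ (n : ℕ) (N₁ : ModuleCat.{0} R)
      (i : N₁ →ₗ[R] (ModuleCat.of R (Fin n → ModuleCat.of R (P × c k))))
      (p : (ModuleCat.of R (Fin n → ModuleCat.of R (P × c k))) →ₗ[R] N),
      SES i p ∧ Module.Finite R N₁ ∧ ∀ j, 1 ≤ j → ExtZero (c k) N₁ j := by
  set W : ModuleCat.{0} R := ModuleCat.of R (P × c k) with hWdef
  have hWf : Module.Finite R W := inferInstanceAs (Module.Finite R (P × c k))
  have hnoeth : IsNoetherianRing R := isNoetherian_of_tower K inferInstance
  obtain ⟨n, φ, hφ⟩ := exists_hom_generators K W N hWf hN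
  let B : ModuleCat.{0} R := ModuleCat.of R (Fin n → W)
  let p : B →ₗ[R] N := ∑ i, φ i ∘ₗ LinearMap.proj (R := R) (φ := fun _ => (W : Type)) i
  have hp : ∀ b : B, p b = ∑ i, φ i ((b : Fin n → W) i) := fun b => by
    simp only [p, LinearMap.sum_apply, LinearMap.comp_apply]; rfl
  have liftW : ∀ u : W →ₗ[R] N, ∃ v : W →ₗ[R] B, p ∘ₗ v = u := fun u => by
    obtain ⟨e, he⟩ := hφ u
    refine ⟨LinearMap.pi e, ?_⟩
    refine LinearMap.ext fun w => ?_
    rw [LinearMap.comp_apply, hp]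
    exact he w
  have liftP : ∀ u : P →ₗ[R] N, ∃ v : P →ₗ[R] B, p ∘ₗ v = u := fun u => by
    obtain ⟨v, hv⟩ := liftW (u ∘ₗ LinearMap.fst R P (c k))
    refine ⟨v ∘ₗ LinearMap.inl R P (c k), ?_⟩
    rw [← LinearMap.comp_assoc, hv]; ext x; rfl
  have liftc : ∀ u : c k →ₗ[R] N, ∃ v : c k →ₗ[R] B, p ∘ₗ v = u := fun u => by
    obtain ⟨v, hv⟩ := liftW (u ∘ₗ LinearMap.snd R P (c k))
    refine ⟨v ∘ₗ LinearMap.inr R P (c k), ?_⟩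
    rw [← LinearMap.comp_assoc, hv]; ext x; rfl
  have hsurj : Function.Surjective p := by
    intro x
    obtain ⟨e⟩ := h.start
    obtain ⟨a, b, hab⟩ := h.ses 0 (by omega)
    have h1 : ExtZero (c (0+1)) N 1 := by
      rw [← h.shift hP N le_rfl (k-1) (0+1) (by omega)]
      have : 0 + 1 + (k - 1) = k := by omega
      rw [this]
      exact hNc _ (by omega)
    obtain ⟨u, o, huo⟩ := exists_from_reg N x
    obtain ⟨v, hv⟩ := hab.extend h1 (u ∘ₗ e.symm.toLinearMap)
    obtain ⟨w, hw⟩ := lift_of_memAdd p (h.mem 0 (by omega)) liftP v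
    refine ⟨w (a (e o)), ?_⟩
    have h2 := LinearMap.congr_fun hw (a (e o))
    have h3 := LinearMap.congr_fun hv (e o)
    simp only [LinearMap.comp_apply] at h2 h3
    rw [h2, h3, ← huo]
    exact congrArg u (e.symm_apply_apply o)
  have hses := SES.kernel (n := p) hsurj
  have hcW : ∀ j, 1 ≤ j → ExtZero (c k) W j := fun j hj =>
    extZero_of_two_right (Z := P) (W := c k) (LinearMap.fst R P (c k)) (LinearMap.inl R P (c k))
      (LinearMap.snd R P (c k)) (LinearMap.inr R P (c k)) (fun x => by
        obtain ⟨a, b⟩ : P × c k := x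
        exact Prod.ext (add_zero a) (zero_add b)) (hcP j hj) (hcc j hj)
  have hcB : ∀ j, 1 ≤ j → ExtZero (c k) B j := fun j hj =>
    extZero_of_memAdd_right (X := W) ⟨n, LinearMap.id, LinearMap.id, rfl⟩ (hcW j hj)
  refine ⟨n, ModuleCat.of R (LinearMap.ker p), (LinearMap.ker p).subtype, p, hses, ?_, ?_⟩
  · have : Module.Finite R B := inferInstanceAs (Module.Finite R (Fin n → W))
    have : IsNoetherian R B := isNoetherian_of_isNoetherianRing_of_finite R B
    exact inferInstanceAs (Module.Finite R (LinearMap.ker p))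
  · intro j hj
    obtain ⟨j, rfl⟩ : ∃ m, j = m + 1 := ⟨j - 1, by omega⟩
    cases j with
    | zero => exact hses.ext_right_one liftc (hcB 1 le_rfl)
    | succ j => exact hses.ext_right₁ (hNc _ (by omega)) (hcB _ (by omega))

lemma tilting_memAdd (K : Type) [Field K] [Algebra K R] [FiniteDimensional K R] (h : Cores P k c Q) (hk : 1 ≤ k)
    (hP : Module.Projective R P) (hT : IsTilting k T)
    (hPT : MemAdd T P) (hcT : MemAdd T (c k)) :
    MemAdd (ModuleCat.of R (P × c k)) T := by
  obtain ⟨hTf, hpd, hext, -⟩ := hT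
  have approx := exists_approx K h hk hP (finite_of_memAdd hPT hTf) (finite_of_memAdd hcT hTf)
    (fun j hj => extZero_of_memAdd hcT (extZero_of_memAdd_right hPT (hext j hj)))
    (fun j hj => extZero_of_memAdd hcT (extZero_of_memAdd_right hcT (hext j hj)))
  have hTB : ∀ n j, 1 ≤ j → ExtZero T (ModuleCat.of R (Fin n → ModuleCat.of R (P × c k))) j :=
    fun n j hj => extZero_of_memAdd_right (X := ModuleCat.of R (P × c k))
      ⟨n, LinearMap.id, LinearMap.id, rfl⟩
      (extZero_of_two_right (Z := P) (W := c k) (LinearMap.fst R P (c k))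
        (LinearMap.inl R P (c k)) (LinearMap.snd R P (c k)) (LinearMap.inr R P (c k))
        (fun x => by simp) (extZero_of_memAdd_right hPT (hext j hj))
        (extZero_of_memAdd_right hcT (hext j hj)))
  have key : ∀ m j, 1 ≤ j → k + 1 ≤ j + m → ∀ N : ModuleCat.{0} R, Module.Finite R N →
      (∀ j, 1 ≤ j → ExtZero (c k) N j) → ExtZero T N j := by
    intro m
    induction m with
    | zero => intro j _ hjk N _ _; exact hpd.extZero N hjk
    | succ m ih =>
      intro j hj hjk N hN hNc
      obtain ⟨n, N₁, i, p, hses, hf, hv⟩ := approx N hN hNc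
      exact hses.ext_right₃ (hTB n j hj) (ih (j+1) (by omega) (by omega) N₁ hf hv)
  obtain ⟨n, N₁, i, p, hses, hf, hv⟩ := approx T hTf
    (fun j hj => extZero_of_memAdd hcT (hext j hj))
  obtain ⟨v, hv'⟩ := hses.lift (key k 1 le_rfl (by omega) N₁ hf hv) LinearMap.id
  exact ⟨n, v, p, hv'⟩

/-- Everything we need about a special tilting module. -/
lemma special_data (K : Type) [Field K] [Algebra K R] [FiniteDimensional K R] (hk : 1 ≤ k)
    (hP : IsMaxProjInjSummand P) (hT : IsSpecialTilting P k T) :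
    ∃ c Q : ℕ → ModuleCat.{0} R, Cores P k c Q ∧ MemAdd T P ∧ MemAdd T (c k) ∧
      (∀ M n, ExtZero P M n → ExtZero (c k) M n → ExtZero T M n) := by
  obtain ⟨c, Q, hc, hcT, hQT⟩ := hT.cores
  have hPT := hc.proj_memAdd hk hP.2.1.2 hP.1 (hQT 0 (by omega))
  refine ⟨c, Q, hc, hPT, hcT, fun M n h1 h2 => ?_⟩
  refine extZero_of_memAdd (tilting_memAdd K hc hk hP.2.1.1 hT.1 hPT hcT) ?_
  exact extZero_of_two (Z := P) (W := c k) (LinearMap.fst R P (c k))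
        (LinearMap.inl R P (c k)) (LinearMap.snd R P (c k)) (LinearMap.inr R P (c k))
        (fun x => by simp) h1 h2

lemma SES.hom_zero {A B C M : ModuleCat.{0} R} {f : A →ₗ[R] B} {g : B →ₗ[R] C} (h : SES f g)
    (hB : ExtZero B M 0) : ExtZero C M 0 := by
  rw [extZero_zero_iff] at *
  refine subsingleton_of_forall_eq 0 fun u => ?_
  ext x
  obtain ⟨y, rfl⟩ := h.surj x
  exact LinearMap.congr_fun (hB.elim (u ∘ₗ g) 0) y

lemma part_two (K : Type) [Field K] [Algebra K R] [FiniteDimensional K R] (hk : 1 ≤ k)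
    (hP : IsMaxProjInjSummand P) (hT : IsSpecialTilting P k T) (M : ModuleCat.{0} R) :
    (∀ i : ℕ, i ≠ k → ExtZero T M i) ↔ Subsingleton (P →ₗ[R] M) := by
  obtain ⟨c, Q, hc, hPT, hcT, hsuf⟩ := special_data K hk hP hT
  rw [← extZero_zero_iff]
  constructor
  · intro h
    exact extZero_of_memAdd hPT (h 0 (by omega))
  · intro h i hi
    have hQ : ∀ i, i < k → ExtZero (Q i) M 0 := fun i hi => extZero_of_memAdd (hc.mem i hi) h
    have hc0 : ∀ i, 1 ≤ i → i ≤ k → ExtZero (c i) M 0 := by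
      intro i h1 h2
      obtain ⟨i, rfl⟩ : ∃ m, i = m + 1 := ⟨i - 1, by omega⟩
      obtain ⟨a, b, hab⟩ := hc.ses i (by omega)
      exact hab.hom_zero (hQ i (by omega))
    have hPn : ∀ n, ExtZero P M n := fun n => by
      rcases Nat.eq_zero_or_pos n with rfl | hn
      · exact h
      · exact extZero_of_projective hP.2.1.1 M hn
    refine hsuf M i (hPn i) ?_
    rcases Nat.lt_or_gt_of_ne hi with hi | hi
    · rcases Nat.eq_zero_or_pos i with rfl | hi0
      · exact hc0 k hk le_rfl
      · have h1 : ExtZero (c (k - i + 1)) M 1 := by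
          obtain ⟨a, b, hab⟩ := hc.ses (k - i) (by omega)
          exact hab.ext_left₃ (hc0 _ (by omega) (by omega)) (extZero_of_projective
            (projective_of_memAdd hP.2.1.1 (hc.mem _ (by omega))) M le_rfl)
        have := (hc.shift hP.2.1.1 M le_rfl (i - 1) (k - i + 1) (by omega)).2 h1
        have e1 : k - i + 1 + (i - 1) = k := by omega
        have e2 : 1 + (i - 1) = i := by omega
        rwa [e1, e2] at this
    · exact hc.extZero_gt hP.2.1.1 M hi

lemma part_three (K : Type) [Field K] [Algebra K R] [FiniteDimensional K R] (hk : 1 ≤ k)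
    (hP : IsMaxProjInjSummand P) (hT : IsSpecialTilting P k T) (j : ℕ) (hj0 : j ≠ 0)
    (hjk : j ≠ k) (M : ModuleCat.{0} R) (h : ∀ i : ℕ, i ≠ j → ExtZero T M i) :
    Subsingleton M := by
  obtain ⟨c, Q, hc, hPT, hcT, hsuf⟩ := special_data K hk hP hT
  have hP0 : ExtZero P M 0 := extZero_of_memAdd hPT (h 0 hj0.symm)
  have hck : ExtZero (c k) M k := extZero_of_memAdd hcT (h k hjk.symm)
  have h1 : ExtZero (c (0 + 1)) M 1 := by
    rw [← hc.shift hP.2.1.1 M le_rfl (k - 1) (0 + 1) (by omega)]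
    have e1 : 0 + 1 + (k - 1) = k := by omega
    have e2 : 1 + (k - 1) = k := by omega
    have e3 : ExtZero (c (0 + 1 + (k - 1))) M (1 + (k - 1)) := by
      convert hck
    exact e3
  obtain ⟨a, b, hab⟩ := hc.ses 0 (by omega)
  have h0 := hab.ext_left₁ (extZero_of_memAdd (hc.mem 0 (by omega)) hP0) h1
  obtain ⟨e⟩ := hc.start
  have hr : ExtZero (reg R) M 0 := ExtZero.congr e.symm h0
  rw [extZero_zero_iff] at hr
  refine subsingleton_of_forall_eq 0 fun x => ?_
  obtain ⟨u, o, rfl⟩ := exists_from_reg M x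
  exact LinearMap.congr_fun (hr.elim u 0) o

end Approx
end PS

open PS in
/-- Proposition `subcat-calcs`.
Let `domdim Γ = d`, `Π` the maximal projective-injective summand, `1 ≤ k ≤ d`, and let
`T_i` (`i ≤ d`) denote the shifted modules.  Then the tilting subcategory
`T_j(T_k) = ∩_{i ≠ j} Ker Ext^i(T_k, −)` equals `∩_{i=1}^k Ker Ext^1(T_i, −)` for `j = 0`,
`Ker Hom(Π, −)` for `j = k`, and `{0}` otherwise. -/
theorem statement16 (K : Type) [Field K] (Γ : Type) [Ring Γ] [Algebra K Γ]
    [FiniteDimensional K Γ] (hbasic : IsBasic (reg Γ)) (d k : ℕ)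
    (hdom : DomdimEq Γ d) (hd : 0 < d) (hk1 : 1 ≤ k) (hkd : k ≤ d)
    (Pii : ModuleCat.{0} Γ) (hPii : IsMaxProjInjSummand Pii)
    (Tmod : ℕ → ModuleCat.{0} Γ)
    (hTmod : ∀ i, i ≤ d → IsBasic (Tmod i) ∧ IsSpecialTilting Pii i (Tmod i)) :
    -- j = 0
    (∀ M : ModuleCat.{0} Γ,
      (∀ i : ℕ, i ≠ 0 → ExtZero (Tmod k) M i) ↔
        (∀ i : ℕ, 1 ≤ i → i ≤ k → ExtZero (Tmod i) M 1)) ∧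
    -- j = k
    (∀ M : ModuleCat.{0} Γ,
      (∀ i : ℕ, i ≠ k → ExtZero (Tmod k) M i) ↔ Subsingleton (Pii →ₗ[Γ] M)) ∧
    -- other j
    (∀ j : ℕ, j ≠ 0 → j ≠ k →
      ∀ M : ModuleCat.{0} Γ, (∀ i : ℕ, i ≠ j → ExtZero (Tmod k) M i) → Subsingleton M) := by
  refine ⟨fun M => ?_, part_two K hk1 hPii (hTmod k hkd).2,
    part_three K hk1 hPii (hTmod k hkd).2⟩
  obtain ⟨c, Q, hc, hPT, hcT, hsuf⟩ := special_data K hk1 hPii (hTmod k hkd).2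
  have hpi := hPii.2.1
  -- `Ext¹(T_i, M)` is governed by the `i`-th cosyzygy in the `k`-th coresolution.
  have key : ∀ i, 1 ≤ i → i ≤ k → (ExtZero (Tmod i) M 1 ↔ ExtZero (c i) M 1) := by
    intro i h1 h2
    obtain ⟨c', Q', hc', hPT', hcT', hsuf'⟩ :=
      special_data K h1 hPii (hTmod i (h2.trans hkd)).2
    constructor
    · intro h
      exact (hc.mono h2).extZero_of_cores hpi hc' le_rfl le_rfl (extZero_of_memAdd hcT' h)
    · intro h
      exact hsuf' M 1 (extZero_of_projective hpi.1 M le_rfl)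
        (hc'.extZero_of_cores hpi (hc.mono h2) le_rfl le_rfl h)
  have shift : ∀ i, 1 ≤ i → i ≤ k → (ExtZero (c k) M (1 + (k - i)) ↔ ExtZero (c i) M 1) := by
    intro i h1 h2
    have := hc.shift hpi.1 M (n := 1) le_rfl (k - i) i (by omega)
    rwa [show i + (k - i) = k by omega] at this
  constructor
  · intro h i h1 h2
    rw [key i h1 h2, ← shift i h1 h2]
    exact extZero_of_memAdd hcT (h _ (by omega))
  · intro h i hi
    refine hsuf M i (extZero_of_projective hpi.1 M (by omega)) ?_
    rcases Nat.lt_or_ge k i with hik | hik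
    · exact hc.extZero_gt hpi.1 M hik
    · have := (shift (k + 1 - i) (by omega) (by omega)).2
        ((key _ (by omega) (by omega)).1 (h _ (by omega) (by omega)))
      rwa [show 1 + (k - (k + 1 - i)) = i by omega] at this
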